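/- arXiv:1306.2740 — 6 statements merged into one kernel-verified Lean document; each statement's English description precedes it below -/
import Mathlib

section
/- (Partial Hamiltonian version of the partial Noether theorem.) Let n be a positive integer and let H, B, ξ : ℝ × ℝⁿ × ℝⁿ → ℝ and η, ζ, Γ : ℝ × ℝⁿ × ℝⁿ → ℝⁿ be differentiable. Let (q, p) : ℝ → ℝⁿ × ℝⁿ be a differentiable solution of the partial Hamiltonian system q̇ᵢ = ∂H/∂pᵢ, ṗᵢ = −∂H/∂qᵢ + Γᵢ (all partial derivatives evaluated at (t, q(t), p(t))). Then for each t, the partial Hamiltonian operator determining condition Σᵢ ζᵢ ∂H/∂pᵢ + Σᵢ pᵢ D(ηᵢ) − X(H) − H D(ξ) = D(B) + Σᵢ (ηᵢ − ξ ∂H/∂pᵢ)(−Γᵢ) holds at t if and only if d/dt [Σᵢ pᵢ(t) ηᵢ(t, q(t), p(t)) − ξ(t, q(t), p(t)) H(t, q(t), p(t)) − B(t, q(t), p(t))] = 0 at t. In particular, the determining condition holds along all solutions if and only if I = Σᵢ pᵢ ηᵢ − ξ H − B is a first integral of the system. -/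
/-- partial Hamiltonian version of the partial Noether theorem:
Along any differentiable solution `(q, p)` of the partial Hamiltonian system
`q̇ᵢ = ∂H/∂pᵢ`, `ṗᵢ = −∂H/∂qᵢ + Γᵢ`, at each time `t` the determining condition
`Σᵢ ζᵢ ∂H/∂pᵢ + Σᵢ pᵢ D(ηᵢ) − X(H) − H D(ξ) = D(B) + Σᵢ (ηᵢ − ξ ∂H/∂pᵢ)(−Γᵢ)`
holds if and only if `d/dt [Σᵢ pᵢ ηᵢ − ξ H − B] = 0`; hence the determining
condition holds along all solutions iff `I = Σᵢ pᵢ ηᵢ − ξ H − B` is a first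
integral. -/
theorem partial_hamiltonian_noether
    (n : ℕ) (hn : 0 < n)
    (H B ξ : ℝ × (Fin n → ℝ) × (Fin n → ℝ) → ℝ)
    (η ζ Γ : ℝ × (Fin n → ℝ) × (Fin n → ℝ) → Fin n → ℝ)
    (hH : Differentiable ℝ H) (hB : Differentiable ℝ B) (hξ : Differentiable ℝ ξ)
    (hη : Differentiable ℝ η) (hζ : Differentiable ℝ ζ) (hΓ : Differentiable ℝ Γ)
    (q p : ℝ → Fin n → ℝ) (hq : Differentiable ℝ q) (hp : Differentiable ℝ p)
    (hsys1 : ∀ (t : ℝ) (i : Fin n), deriv (fun s => q s i) t =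
      fderiv ℝ H (t, q t, p t) (0, 0, Pi.single i 1))
    (hsys2 : ∀ (t : ℝ) (i : Fin n), deriv (fun s => p s i) t =
      - fderiv ℝ H (t, q t, p t) (0, Pi.single i 1, 0) + Γ (t, q t, p t) i) :
    ∀ t : ℝ,
      ((∑ i : Fin n, ζ (t, q t, p t) i * fderiv ℝ H (t, q t, p t) (0, 0, Pi.single i 1))
        + (∑ i : Fin n, p t i * deriv (fun s => η (s, q s, p s) i) t)
        - (ξ (t, q t, p t) * fderiv ℝ H (t, q t, p t) (1, 0, 0)
            + ∑ i : Fin n, η (t, q t, p t) i * fderiv ℝ H (t, q t, p t) (0, Pi.single i 1, 0)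
            + ∑ i : Fin n, ζ (t, q t, p t) i * fderiv ℝ H (t, q t, p t) (0, 0, Pi.single i 1))
        - H (t, q t, p t) * deriv (fun s => ξ (s, q s, p s)) t
        =
        deriv (fun s => B (s, q s, p s)) t
        + ∑ i : Fin n,
            (η (t, q t, p t) i
              - ξ (t, q t, p t) * fderiv ℝ H (t, q t, p t) (0, 0, Pi.single i 1))
            * (- Γ (t, q t, p t) i))
      ↔
      deriv (fun s =>
        (∑ i : Fin n, p s i * η (s, q s, p s) i)
        - ξ (s, q s, p s) * H (s, q s, p s)
        - B (s, q s, p s)) t = 0 := by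
  intro t
  have hc : HasDerivAt (fun s => (s, q s, p s)) ((1 : ℝ), deriv q t, deriv p t) t :=
    (hasDerivAt_id t).prodMk ((hq t).hasDerivAt.prodMk (hp t).hasDerivAt)
  have hcd := hc.differentiableAt
  have hHd : HasDerivAt (fun s => H (s, q s, p s))
      (fderiv ℝ H (t, q t, p t) (1, deriv q t, deriv p t)) t :=
    (hH (t, q t, p t)).hasFDerivAt.comp_hasDerivAt t hc
  have hBd : HasDerivAt (fun s => B (s, q s, p s)) (deriv (fun s => B (s, q s, p s)) t) t :=
    ((hB (t, q t, p t)).comp t hcd).hasDerivAt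
  have hξd : HasDerivAt (fun s => ξ (s, q s, p s)) (deriv (fun s => ξ (s, q s, p s)) t) t :=
    ((hξ (t, q t, p t)).comp t hcd).hasDerivAt
  have hηd : ∀ i, HasDerivAt (fun s => η (s, q s, p s) i)
      (deriv (fun s => η (s, q s, p s) i) t) t := fun i =>
    (differentiableAt_pi.1 ((hη (t, q t, p t)).comp t hcd) i).hasDerivAt
  have hpd : ∀ i, HasDerivAt (fun s => p s i) (deriv (fun s => p s i) t) t := fun i =>
    (differentiableAt_pi.1 (hp t) i).hasDerivAt
  have hq1 : ∀ i, deriv q t i = deriv (fun s => q s i) t := fun i =>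
    ((hasDerivAt_pi.1 (hq t).hasDerivAt i).deriv).symm
  have hp1 : ∀ i, deriv p t i = deriv (fun s => p s i) t := fun i =>
    ((hasDerivAt_pi.1 (hp t).hasDerivAt i).deriv).symm
  have hvec : ((1 : ℝ), deriv q t, deriv p t) = ((1 : ℝ), (0 : Fin n → ℝ), (0 : Fin n → ℝ))
      + ∑ i : Fin n, (deriv q t i • ((0 : ℝ), (Pi.single i 1 : Fin n → ℝ), (0 : Fin n → ℝ))
      + deriv p t i • ((0 : ℝ), (0 : Fin n → ℝ), (Pi.single i 1 : Fin n → ℝ))) := by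
    refine Prod.ext ?_ (Prod.ext ?_ ?_)
    · simp [Prod.fst_sum]
    · ext j
      simp [Prod.fst_sum, Prod.snd_sum, Finset.sum_apply, Pi.single_apply]
    · ext j
      simp [Prod.snd_sum, Finset.sum_apply, Pi.single_apply]
  have hI := ((HasDerivAt.fun_sum (u := Finset.univ)
    (fun i _ => (hpd i).mul (hηd i))).sub (hξd.mul hHd)).sub hBd
  have hE : fderiv ℝ H (t, q t, p t) (1, deriv q t, deriv p t)
      = fderiv ℝ H (t, q t, p t) (1, 0, 0)
        + ∑ i, fderiv ℝ H (t, q t, p t) (0, 0, Pi.single i 1) * Γ (t, q t, p t) i := by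
    rw [hvec, map_add, map_sum]
    congr 1
    refine Finset.sum_congr rfl fun i _ => ?_
    rw [map_add, map_smul, map_smul, hq1, hp1, hsys1, hsys2, smul_eq_mul, smul_eq_mul]
    ring
  have hI' := hI.deriv
  have hfun : deriv (fun s =>
        (∑ i : Fin n, p s i * η (s, q s, p s) i)
        - ξ (s, q s, p s) * H (s, q s, p s)
        - B (s, q s, p s)) t = _ := hI'
  rw [hfun, hE]
  have h1 : ∑ i, (deriv (fun s => p s i) t * η (t, q t, p t) i
        + p t i * deriv (fun s => η (s, q s, p s) i) t)
      = - (∑ i, η (t, q t, p t) i * fderiv ℝ H (t, q t, p t) (0, Pi.single i 1, 0))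
        + ∑ i, η (t, q t, p t) i * Γ (t, q t, p t) i
        + ∑ i, p t i * deriv (fun s => η (s, q s, p s) i) t := by
    rw [← Finset.sum_neg_distrib, ← Finset.sum_add_distrib, ← Finset.sum_add_distrib]
    refine Finset.sum_congr rfl fun i _ => ?_
    rw [hsys2]
    ring
  have h2 : ∑ i, (η (t, q t, p t) i
              - ξ (t, q t, p t) * fderiv ℝ H (t, q t, p t) (0, 0, Pi.single i 1))
            * (- Γ (t, q t, p t) i)
      = - (∑ i, η (t, q t, p t) i * Γ (t, q t, p t) i)
        + ξ (t, q t, p t) *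
          ∑ i, fderiv ℝ H (t, q t, p t) (0, 0, Pi.single i 1) * Γ (t, q t, p t) i := by
    rw [← Finset.sum_neg_distrib, Finset.mul_sum, ← Finset.sum_add_distrib]
    refine Finset.sum_congr rfl fun i _ => ?_
    ring
  rw [h1, h2]
  constructor <;> intro h <;> linarith
end

section
/- (Hamiltonian version of Noether's theorem, canonical case.) Let n be a positive integer and let H, B, ξ : ℝ × ℝⁿ × ℝⁿ → ℝ and η, ζ : ℝ × ℝⁿ × ℝⁿ → ℝⁿ be differentiable. Let (q, p) : ℝ → ℝⁿ × ℝⁿ be a differentiable solution of the canonical Hamilton equations q̇ᵢ = ∂H/∂pᵢ, ṗᵢ = −∂H/∂qᵢ (partial derivatives evaluated at (t, q(t), p(t))). Then for each t, the invariance condition Σᵢ ζᵢ ∂H/∂pᵢ + Σᵢ pᵢ D(ηᵢ) − X(H) − H D(ξ) − D(B) = 0 holds at t if and only if d/dt [Σᵢ pᵢ(t) ηᵢ(t, q(t), p(t)) − ξ(t, q(t), p(t)) H(t, q(t), p(t)) − B(t, q(t), p(t))] = 0 at t; consequently I = Σᵢ pᵢ ηᵢ − ξ H − B is a first integral of the canonical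 system if and only if the invariance condition holds along all solutions. -/
/-- Hamiltonian version of Noether's theorem, canonical case:
Along any differentiable solution `(q, p)` of the canonical Hamilton equations
`q̇ᵢ = ∂H/∂pᵢ`, `ṗᵢ = −∂H/∂qᵢ`, at each time `t` the invariance condition
`Σᵢ ζᵢ ∂H/∂pᵢ + Σᵢ pᵢ D(ηᵢ) − X(H) − H D(ξ) − D(B) = 0` holds if and only if
`d/dt [Σᵢ pᵢ ηᵢ − ξ H − B] = 0`; consequently `I = Σᵢ pᵢ ηᵢ − ξ H − B` is a
first integral iff the invariance condition holds along all solutions. -/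
theorem hamiltonian_noether_canonical
    (n : ℕ) (hn : 0 < n)
    (H B ξ : ℝ × (Fin n → ℝ) × (Fin n → ℝ) → ℝ)
    (η ζ : ℝ × (Fin n → ℝ) × (Fin n → ℝ) → Fin n → ℝ)
    (hH : Differentiable ℝ H) (hB : Differentiable ℝ B) (hξ : Differentiable ℝ ξ)
    (hη : Differentiable ℝ η) (hζ : Differentiable ℝ ζ)
    (q p : ℝ → Fin n → ℝ) (hq : Differentiable ℝ q) (hp : Differentiable ℝ p)
    (hsys1 : ∀ (t : ℝ) (i : Fin n), deriv (fun s => q s i) t =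
      fderiv ℝ H (t, q t, p t) (0, 0, Pi.single i 1))
    (hsys2 : ∀ (t : ℝ) (i : Fin n), deriv (fun s => p s i) t =
      - fderiv ℝ H (t, q t, p t) (0, Pi.single i 1, 0)) :
    ∀ t : ℝ,
      ((∑ i : Fin n, ζ (t, q t, p t) i * fderiv ℝ H (t, q t, p t) (0, 0, Pi.single i 1))
        + (∑ i : Fin n, p t i * deriv (fun s => η (s, q s, p s) i) t)
        - (ξ (t, q t, p t) * fderiv ℝ H (t, q t, p t) (1, 0, 0)
            + ∑ i : Fin n, η (t, q t, p t) i * fderiv ℝ H (t, q t, p t) (0, Pi.single i 1, 0)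
            + ∑ i : Fin n, ζ (t, q t, p t) i * fderiv ℝ H (t, q t, p t) (0, 0, Pi.single i 1))
        - H (t, q t, p t) * deriv (fun s => ξ (s, q s, p s)) t
        - deriv (fun s => B (s, q s, p s)) t = 0)
      ↔
      deriv (fun s =>
        (∑ i : Fin n, p s i * η (s, q s, p s) i)
        - ξ (s, q s, p s) * H (s, q s, p s)
        - B (s, q s, p s)) t = 0 := by
  intro t
  have hc : ∀ s, HasDerivAt (fun s => (s, q s, p s)) ((1 : ℝ), deriv q s, deriv p s) s := fun s =>
    (hasDerivAt_id s).prodMk ((hq s).hasDerivAt.prodMk (hp s).hasDerivAt)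
  have hqi : ∀ i, deriv q t i = fderiv ℝ H (t, q t, p t) (0, 0, Pi.single i 1) := fun i => by
    rw [← hsys1 t i]
    exact ((hasDerivAt_pi.1 (hq t).hasDerivAt) i).deriv.symm
  have hpi : ∀ i, HasDerivAt (fun s => p s i)
      (-fderiv ℝ H (t, q t, p t) (0, Pi.single i 1, 0)) t := fun i => by
    rw [← hsys2 t i]
    exact ((hasDerivAt_pi.1 (hp t).hasDerivAt) i).differentiableAt.hasDerivAt
  have hpi' : ∀ i, deriv p t i = -fderiv ℝ H (t, q t, p t) (0, Pi.single i 1, 0) := fun i =>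
    ((hasDerivAt_pi.1 (hp t).hasDerivAt) i).unique (hpi i)
  -- Along a solution, the total time derivative of `H` is its partial time derivative.
  have hHt : HasDerivAt (fun s => H (s, q s, p s)) (fderiv ℝ H (t, q t, p t) (1, 0, 0)) t := by
    have h := (hH (t, q t, p t)).hasFDerivAt.comp_hasDerivAt t (hc t)
    have hv : ((1 : ℝ), deriv q t, deriv p t) = (1, 0, 0)
        + ∑ i, (deriv q t i • ((0 : ℝ), (Pi.single i 1 : Fin n → ℝ), (0 : Fin n → ℝ))
        + deriv p t i • ((0 : ℝ), (0 : Fin n → ℝ), (Pi.single i 1 : Fin n → ℝ))) := by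
      ext j
      · simp [Prod.fst_sum]
      · simp [Prod.fst_sum, Prod.snd_sum, Finset.sum_apply, Pi.single_apply]
      · simp [Prod.snd_sum, Finset.sum_apply, Pi.single_apply]
    have he : fderiv ℝ H (t, q t, p t) (1, deriv q t, deriv p t)
        = fderiv ℝ H (t, q t, p t) (1, 0, 0) := by
      rw [hv, map_add, map_sum, Finset.sum_eq_zero, add_zero]
      intro i _
      rw [map_add, map_smul, map_smul, hqi, hpi', smul_eq_mul, smul_eq_mul]
      ring
    rw [he] at h
    exact h
  have hηi : ∀ i, HasDerivAt (fun s => η (s, q s, p s) i)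
      (deriv (fun s => η (s, q s, p s) i) t) t := fun i =>
    ((hasDerivAt_pi.1
      ((hη (t, q t, p t)).hasFDerivAt.comp_hasDerivAt t (hc t))) i).differentiableAt.hasDerivAt
  have hξt : HasDerivAt (fun s => ξ (s, q s, p s)) (deriv (fun s => ξ (s, q s, p s)) t) t :=
    ((hξ (t, q t, p t)).hasFDerivAt.comp_hasDerivAt t (hc t)).differentiableAt.hasDerivAt
  have hBt : HasDerivAt (fun s => B (s, q s, p s)) (deriv (fun s => B (s, q s, p s)) t) t :=
    ((hB (t, q t, p t)).hasFDerivAt.comp_hasDerivAt t (hc t)).differentiableAt.hasDerivAt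
  have hI := ((HasDerivAt.fun_sum (u := Finset.univ)
    (fun i _ => (hpi i).fun_mul (hηi i))).fun_sub (hξt.fun_mul hHt)).fun_sub hBt
  rw [hI.deriv, Finset.sum_add_distrib]
  simp only [neg_mul, Finset.sum_neg_distrib]
  rw [Finset.sum_congr rfl (fun i _ => mul_comm (η (t, q t, p t) i) _)]
  constructor <;> intro h <;> linarith
end

section
/- If (q, p) : ℝ → ℝ × ℝ is a differentiable solution of the system q̇ = (p − 1)/2, ṗ = 4q + p − 1, then the function I₂(t) = [ 2 p(t) q(t) − ( q(t) − 2q(t)² − u(t)² − u(t) + p(t) u(t) ) − 6 q(t)² − q(t) ] e^{2t}, where u(t) = (p(t) − 1)/2, is constant in t. -/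
/-- For any differentiable solution of `q̇ = (p − 1)/2`,
`ṗ = 4q + p − 1`, the quantity
`I₂ = [2 p q − (q − 2q² − u² − u + p u) − 6q² − q] e^{2t}` with `u = (p − 1)/2`
is constant in `t`. -/
theorem first_integral_I2
    (q p : ℝ → ℝ) (hq : Differentiable ℝ q) (hp : Differentiable ℝ p)
    (hsys1 : ∀ t, deriv q t = (p t - 1) / 2)
    (hsys2 : ∀ t, deriv p t = 4 * q t + p t - 1) :
    ∀ t₁ t₂ : ℝ,
      (2 * p t₁ * q t₁
        - (q t₁ - 2 * (q t₁)^2 - ((p t₁ - 1)/2)^2 - ((p t₁ - 1)/2)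
            + p t₁ * ((p t₁ - 1)/2))
        - 6 * (q t₁)^2 - q t₁) * Real.exp (2 * t₁)
      =
      (2 * p t₂ * q t₂
        - (q t₂ - 2 * (q t₂)^2 - ((p t₂ - 1)/2)^2 - ((p t₂ - 1)/2)
            + p t₂ * ((p t₂ - 1)/2))
        - 6 * (q t₂)^2 - q t₂) * Real.exp (2 * t₂) := by
  have hd : ∀ t, HasDerivAt (fun t => ((p t - 1) / 2 - 2 * q t) * Real.exp t) 0 t := by
    intro t
    have h1 := (hq t).hasDerivAt
    have h2 := (hp t).hasDerivAt
    rw [hsys1] at h1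
    rw [hsys2] at h2
    have h := (((h2.sub_const 1).div_const 2).sub (h1.const_mul 2)).mul (Real.hasDerivAt_exp t)
    refine h.congr_deriv ?_
    simp only [Pi.sub_apply]
    ring
  have hc := is_const_of_deriv_eq_zero (fun t => (hd t).differentiableAt) (fun t => (hd t).deriv)
  intro t₁ t₂
  have h := hc t₁ t₂
  have e : ∀ t : ℝ, Real.exp (2 * t) = Real.exp t ^ 2 := by
    intro t
    rw [two_mul, Real.exp_add, sq]
  rw [e, e]
  have h' := congrArg (fun x : ℝ => -x ^ 2) h
  linear_combination h'
end

section
/- Let 0 < β < 1, δ > 0, r > 0 and set σ = (r + δ)/(βδ), with σ ≠ 0, 1 and σβ ≠ 1. If k, c : ℝ → ℝ are differentiable with k(t) > 0 and c(t) > 0 for all t, and satisfy k̇ = k^β − δk − c and ċ/c = (β/σ) k^{β−1} − (δ + r)/σ, then the function I(t) = e^{δβ(1−σ)t} [ −σ c(t)^{1−σ} + (σ − 1) c(t)^{−σ} k(t)^{β} ] is constant in t. -/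
/-- In the Ramsey model with CRRA utility and Cobb–Douglas
technology, with `σ = (r + δ)/(βδ)`, the quantity
`I = e^{δβ(1−σ)t} [−σ c^{1−σ} + (σ−1) c^{−σ} k^{β}]` is constant along any
positive differentiable solution of `k̇ = k^β − δk − c`,
`ċ/c = (β/σ) k^{β−1} − (δ+r)/σ`. -/
theorem ramsey_first_integral
    (β δ r σ : ℝ) (hβ0 : 0 < β) (hβ1 : β < 1) (hδ : 0 < δ) (hr : 0 < r)
    (hσ : σ = (r + δ) / (β * δ)) (hσ0 : σ ≠ 0) (hσ1 : σ ≠ 1) (hσβ : σ * β ≠ 1)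
    (k c : ℝ → ℝ) (hk : Differentiable ℝ k) (hc : Differentiable ℝ c)
    (hkpos : ∀ t, 0 < k t) (hcpos : ∀ t, 0 < c t)
    (hsys1 : ∀ t, deriv k t = k t ^ β - δ * k t - c t)
    (hsys2 : ∀ t, deriv c t / c t = (β / σ) * k t ^ (β - 1) - (δ + r) / σ) :
    ∀ t₁ t₂ : ℝ,
      Real.exp (δ * β * (1 - σ) * t₁) *
        (-σ * c t₁ ^ (1 - σ) + (σ - 1) * c t₁ ^ (-σ) * k t₁ ^ β)
      =
      Real.exp (δ * β * (1 - σ) * t₂) *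
        (-σ * c t₂ ^ (1 - σ) + (σ - 1) * c t₂ ^ (-σ) * k t₂ ^ β) := by
  have hr' : δ + r = σ * (β * δ) := by
    rw [hσ]; field_simp; ring
  have key : ∀ t, HasDerivAt (fun t => Real.exp (δ * β * (1 - σ) * t) *
        (-σ * c t ^ (1 - σ) + (σ - 1) * c t ^ (-σ) * k t ^ β)) 0 t := by
    intro t
    have hcp := hcpos t
    have hkp := hkpos t
    have hk1 := (hk t).hasDerivAt
    have hc1 := (hc t).hasDerivAt
    have hcd : deriv c t = c t * ((β / σ) * k t ^ (β - 1) - β * δ) := by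
      have h := hsys2 t
      rw [div_eq_iff hcp.ne', hr', mul_div_cancel_left₀ _ hσ0] at h
      rw [h]; ring
    rw [hcd] at hc1
    rw [hsys1 t] at hk1
    have hE : HasDerivAt (fun t => Real.exp (δ * β * (1 - σ) * t))
        (Real.exp (δ * β * (1 - σ) * t) * (δ * β * (1 - σ) * 1)) t :=
      ((hasDerivAt_id t).const_mul (δ * β * (1 - σ))).exp
    have h1 := hc1.rpow_const (p := 1 - σ) (Or.inl hcp.ne')
    have h2 := hc1.rpow_const (p := -σ) (Or.inl hcp.ne')
    have h3 := hk1.rpow_const (p := β) (Or.inl hkp.ne')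
    have h := hE.mul ((h1.const_mul (-σ)).add ((h2.const_mul (σ - 1)).mul h3))
    refine h.congr_deriv ?_
    have e1 : c t ^ (1 - σ) = c t ^ (-σ) * c t := by
      rw [show 1 - σ = -σ + 1 by ring, Real.rpow_add_one hcp.ne']
    have e2 : c t ^ (1 - σ - 1) = c t ^ (-σ) := by
      congr 1; ring
    have e3 : c t ^ (-σ - 1) = c t ^ (-σ) / c t := Real.rpow_sub_one hcp.ne' _
    have e4 : k t ^ β = k t ^ (β - 1) * k t := by
      rw [← Real.rpow_add_one hkp.ne']; congr 1; ring
    simp only [Pi.add_apply, Pi.mul_apply]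
    rw [e1, e2, e3, e4]
    generalize c t ^ (-σ) = A
    generalize k t ^ (β - 1) = K
    have := hcp.ne'
    field_simp
    ring
  intro t₁ t₂
  exact is_const_of_deriv_eq_zero (fun t => (key t).differentiableAt) (fun t => (key t).deriv) t₁ t₂
end

section
/- Let θ > 0, θ ≠ 1, and A, δ, ρ, n be real parameters. If k, c : ℝ → ℝ are differentiable with c(t) > 0 for all t and satisfy k̇ = (A − δ − n)k − c and ċ/c = (A − δ − ρ)/θ, then the function I₁(t) = e^{−(ρ−n)t} c(t)^{−θ} k(t) · [ρ − nθ + (θ−1)(A−δ)]/(1−θ) − (θ/(1−θ)) c(t)^{1−θ} e^{−(ρ−n)t} is constant in t. -/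
/-- In the AK model, along any positive differentiable solution of
`k̇ = (A − δ − n)k − c` and `ċ/c = (A − δ − ρ)/θ`, the quantity
`I₁ = e^{−(ρ−n)t} c^{−θ} k [ρ − nθ + (θ−1)(A−δ)]/(1−θ) − (θ/(1−θ)) c^{1−θ} e^{−(ρ−n)t}`
is constant in `t`. -/
theorem ak_first_integral_I1
    (θ A δ ρ n : ℝ) (hθ0 : 0 < θ) (hθ1 : θ ≠ 1)
    (k c : ℝ → ℝ) (hk : Differentiable ℝ k) (hc : Differentiable ℝ c)
    (hcpos : ∀ t, 0 < c t)
    (hsys : ∀ t, deriv k t = (A - δ - n) * k t - c t)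
    (heuler : ∀ t, deriv c t / c t = (A - δ - ρ) / θ) :
    ∀ t₁ t₂ : ℝ,
      Real.exp (-((ρ - n) * t₁)) * c t₁ ^ (-θ) * k t₁ *
          ((ρ - n * θ + (θ - 1) * (A - δ)) / (1 - θ))
        - (θ / (1 - θ)) * c t₁ ^ (1 - θ) * Real.exp (-((ρ - n) * t₁))
      =
      Real.exp (-((ρ - n) * t₂)) * c t₂ ^ (-θ) * k t₂ *
          ((ρ - n * θ + (θ - 1) * (A - δ)) / (1 - θ))
        - (θ / (1 - θ)) * c t₂ ^ (1 - θ) * Real.exp (-((ρ - n) * t₂)) := by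
  have hne : θ ≠ 0 := hθ0.ne'
  have h1 : (1 - θ) ≠ 0 := sub_ne_zero.mpr (Ne.symm hθ1)
  have key : ∀ t : ℝ, HasDerivAt (fun t : ℝ =>
      Real.exp (-((ρ - n) * t)) * c t ^ (-θ) * k t *
          ((ρ - n * θ + (θ - 1) * (A - δ)) / (1 - θ))
        - (θ / (1 - θ)) * c t ^ (1 - θ) * Real.exp (-((ρ - n) * t))) 0 t := by
    intro t
    have hp := hcpos t
    have hcd : deriv c t = (A - δ - ρ) / θ * c t := by
      rw [← heuler t]; field_simp
    have dc : HasDerivAt c ((A - δ - ρ) / θ * c t) t := hcd ▸ (hc t).hasDerivAt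
    have dk : HasDerivAt k ((A - δ - n) * k t - c t) t := hsys t ▸ (hk t).hasDerivAt
    have de : HasDerivAt (fun t : ℝ => Real.exp (-((ρ - n) * t)))
        (Real.exp (-((ρ - n) * t)) * (-((ρ - n) * 1))) t :=
      (((hasDerivAt_id t).const_mul (ρ - n)).neg).exp
    have d1 := dc.rpow_const (p := -θ) (Or.inl hp.ne')
    have d2 := dc.rpow_const (p := 1 - θ) (Or.inl hp.ne')
    have e1 : c t ^ (-θ - 1) = c t ^ (-θ) / c t := Real.rpow_sub_one hp.ne' _
    have e2 : c t ^ (1 - θ) = c t ^ (-θ) * c t := by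
      rw [← Real.rpow_add_one hp.ne']; congr 1; ring
    have e3 : c t ^ (1 - θ - 1) = c t ^ (-θ) := by congr 1; ring
    have d := (((de.mul d1).mul dk).mul_const
      ((ρ - n * θ + (θ - 1) * (A - δ)) / (1 - θ))).sub ((d2.const_mul (θ / (1 - θ))).mul de)
    refine d.congr_deriv ?_
    simp only [Pi.mul_apply]
    rw [e1, e3, e2]
    have hcne := hp.ne'
    field_simp
    ring
  intro t₁ t₂
  exact is_const_of_deriv_eq_zero (fun t => (key t).differentiableAt)
    (fun t => (key t).deriv) t₁ t₂
end

section
/- Let θ > 0, θ ≠ 1, let A, δ, ρ, n be real parameters, set φ = (1/θ)[ρ − nθ + (θ−1)(A−δ)] and assume φ > 0. Let c₀ > 0, let a₁ be a real constant, and define c(t) = c₀ e^{((A−δ−ρ)/θ) t} and k(t) = ((1−θ)/(φθ)) a₁ c₀^{θ} e^{(A−δ−n)t} + (1/φ) c₀ e^{((A−δ−ρ)/θ) t}. Then lim_{t→∞} e^{−(ρ−n)t} c(t)^{−θ} k(t) = ((1−θ)/(φθ)) a₁; in particular, the transversality condition lim_{t→∞} e^{−(ρ−n)t} c(t)^{−θ}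 k(t) = 0 holds if and only if a₁ = 0, in which case k(t) = c(t)/φ for all t. -/
open Filter

/-- With `φ = (1/θ)[ρ − nθ + (θ−1)(A−δ)] > 0` and the explicit AK
paths `c(t) = c₀ e^{((A−δ−ρ)/θ)t}`,
`k(t) = ((1−θ)/(φθ)) a₁ c₀^θ e^{(A−δ−n)t} + (1/φ) c₀ e^{((A−δ−ρ)/θ)t}`, one has
`lim_{t→∞} e^{−(ρ−n)t} c(t)^{−θ} k(t) = ((1−θ)/(φθ)) a₁`; in particular the
transversality condition (this limit being 0) holds iff `a₁ = 0`, in which case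
`k(t) = c(t)/φ` for all `t`. -/
theorem ak_transversality
    (θ A δ ρ n φ c₀ a₁ : ℝ) (hθ0 : 0 < θ) (hθ1 : θ ≠ 1)
    (hφ : φ = (1 / θ) * (ρ - n * θ + (θ - 1) * (A - δ))) (hφpos : 0 < φ)
    (hc₀ : 0 < c₀) :
    let c : ℝ → ℝ := fun t => c₀ * Real.exp ((A - δ - ρ) / θ * t)
    let k : ℝ → ℝ := fun t =>
      ((1 - θ) / (φ * θ)) * a₁ * c₀ ^ θ * Real.exp ((A - δ - n) * t)
        + (1 / φ) * c₀ * Real.exp ((A - δ - ρ) / θ * t)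
    Tendsto (fun t => Real.exp (-((ρ - n) * t)) * c t ^ (-θ) * k t) atTop
        (nhds (((1 - θ) / (φ * θ)) * a₁)) ∧
      (Tendsto (fun t => Real.exp (-((ρ - n) * t)) * c t ^ (-θ) * k t) atTop
          (nhds 0) ↔ a₁ = 0) ∧
      (a₁ = 0 → ∀ t, k t = c t / φ) := by
  intro c k
  have hfun : (fun t => Real.exp (-((ρ - n) * t)) * c t ^ (-θ) * k t)
      = fun t => ((1 - θ) / (φ * θ)) * a₁
          + (1 / φ) * c₀ * c₀ ^ (-θ) * Real.exp (-(φ * t)) := by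
    funext t
    have hc : c t ^ (-θ) = c₀ ^ (-θ) * Real.exp (-((A - δ - ρ) * t)) := by
      simp only [c]
      rw [Real.mul_rpow hc₀.le (Real.exp_pos _).le, ← Real.exp_mul]
      congr 2
      field_simp
    have h1 : c₀ ^ (-θ) * c₀ ^ θ = 1 := by
      rw [← Real.rpow_add hc₀]; simp
    have h2 : Real.exp (-((ρ - n) * t)) * Real.exp (-((A - δ - ρ) * t))
        * Real.exp ((A - δ - n) * t) = 1 := by
      rw [← Real.exp_add, ← Real.exp_add, Real.exp_eq_one_iff]; ring
    have h3 : Real.exp (-((ρ - n) * t)) * Real.exp (-((A - δ - ρ) * t))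
        * Real.exp ((A - δ - ρ) / θ * t) = Real.exp (-(φ * t)) := by
      rw [← Real.exp_add, ← Real.exp_add, hφ]
      congr 1
      field_simp
      ring
    rw [hc, ← h3]
    simp only [k]
    generalize Real.exp (-((ρ - n) * t)) = x at *
    generalize Real.exp (-((A - δ - ρ) * t)) = y at *
    generalize Real.exp ((A - δ - n) * t) = z at *
    generalize c₀ ^ (-θ) = p at *
    generalize c₀ ^ θ = q at *
    linear_combination ((1 - θ) / (φ * θ)) * a₁ * (x * y * z) * h1
      + ((1 - θ) / (φ * θ)) * a₁ * h2
  have hlim : Tendsto (fun t => Real.exp (-((ρ - n) * t)) * c t ^ (-θ) * k t) atTop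
        (nhds (((1 - θ) / (φ * θ)) * a₁)) := by
    rw [hfun]
    have h : Tendsto (fun t : ℝ => Real.exp (-(φ * t))) atTop (nhds 0) :=
      Real.tendsto_exp_neg_atTop_nhds_zero.comp (tendsto_id.const_mul_atTop hφpos)
    simpa using (h.const_mul ((1 / φ) * c₀ * c₀ ^ (-θ))).const_add (((1 - θ) / (φ * θ)) * a₁)
  refine ⟨hlim, ⟨fun h => ?_, fun h => ?_⟩, fun h t => ?_⟩
  · have h0 := tendsto_nhds_unique hlim h
    have hne : (1 - θ) / (φ * θ) ≠ 0 :=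
      div_ne_zero (sub_ne_zero.mpr hθ1.symm) (mul_pos hφpos hθ0).ne'
    exact (mul_eq_zero.mp h0).resolve_left hne
  · have h0 : ((1 - θ) / (φ * θ)) * a₁ = 0 := by rw [h, mul_zero]
    rwa [h0] at hlim
  · simp only [k, c, h]
    ring
end
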